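/- arXiv:2601.08407 — 3 statements merged into one kernel-verified Lean document; each statement's English description precedes it below -/
import Mathlib

section
/- Let X be a compact metric space and f : X → X a continuous surjective map that is chain continuous at every point of X. Then X is totally disconnected. -/
open Filter Topology

variable {X : Type*} [MetricSpace X]

/-- The ω-limit set of `x` under `f`: points `y` with `f^[φ j] x → y` for some
strictly increasing sequence `φ`. -/
def omegaLimitPt (f : X → X) (x : X) : Set X :=
  {y | ∃ φ : ℕ → ℕ, StrictMono φ ∧ Tendsto (fun j => f^[φ j] x) atTop (𝓝 y)}

/-- The set `Ω_f(x)`: points `y` such that there are `x_j → x` and a strictly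
increasing sequence `φ` with `f^[φ j] (x_j) → y`. -/
def bigOmega (f : X → X) (x : X) : Set X :=
  {y | ∃ (xs : ℕ → X) (φ : ℕ → ℕ), StrictMono φ ∧
    Tendsto xs atTop (𝓝 x) ∧ Tendsto (fun j => f^[φ j] (xs j)) atTop (𝓝 y)}

/-- `x` is a shadowable point for `f`. -/
def ShadowablePoint (f : X → X) (x : X) : Prop :=
  ∀ ε > 0, ∃ δ > 0, ∀ xs : ℕ → X, (∀ i, dist (f (xs i)) (xs (i + 1)) ≤ δ) →
    xs 0 = x → ∃ y, ∀ i, dist (xs i) (f^[i] y) ≤ ε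

/-- `x` is an upper semicontinuity point of the ω-limit set map. -/
def USCPoint (f : X → X) (x : X) : Prop :=
  ∀ U : Set X, IsOpen U → omegaLimitPt f x ⊆ U →
    ∃ δ > 0, ∀ y, dist x y ≤ δ → omegaLimitPt f y ⊆ U

/-- `x` is a lower semicontinuity point of the ω-limit set map. -/
def LSCPoint (f : X → X) (x : X) : Prop :=
  ∀ U : Set X, IsOpen U → (omegaLimitPt f x ∩ U).Nonempty →
    ∃ δ > 0, ∀ y, dist x y ≤ δ → (omegaLimitPt f y ∩ U).Nonempty

/-- `(c i)_{i=0}^k` is a `δ`-chain of `f` (with `k ≥ 1`). -/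
def IsDeltaChain (f : X → X) (δ : ℝ) (c : ℕ → X) (k : ℕ) : Prop :=
  1 ≤ k ∧ ∀ i < k, dist (f (c i)) (c (i + 1)) ≤ δ

/-- `y → z`: for every `δ > 0` there is a `δ`-chain of `f` from `y` to `z`. -/
def ChainReach (f : X → X) (y z : X) : Prop :=
  ∀ δ > 0, ∃ (c : ℕ → X) (k : ℕ), IsDeltaChain f δ c k ∧ c 0 = y ∧ c k = z

/-- A set `S` is chain stable: `y ∈ S` and `y → z` imply `z ∈ S`. -/
def ChainStable (f : X → X) (S : Set X) : Prop :=
  ∀ y ∈ S, ∀ z, ChainReach f y z → z ∈ S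

/-- The set `ω_f*(x)`: points reachable from `x` by arbitrarily fine and
arbitrarily long `δ`-chains. -/
def omegaStar (f : X → X) (x : X) : Set X :=
  {y | ∀ δ > 0, ∀ l : ℕ, 1 ≤ l → ∃ (c : ℕ → X) (k : ℕ),
    l ≤ k ∧ IsDeltaChain f δ c k ∧ c 0 = x ∧ c k = y}

/-- The chain component of a point `p`. -/
def chainComponent (f : X → X) (p : X) : Set X :=
  {q | ChainReach f p q ∧ ChainReach f q p}

/-- `f` is chain continuous at `x`. -/
def ChainContinuousAt (f : X → X) (x : X) : Prop :=
  ∀ ε > 0, ∃ δ > 0, ∀ xs : ℕ → X, (∀ i, dist (f (xs i)) (xs (i + 1)) ≤ δ) →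
    xs 0 = x → ∀ i, dist (xs i) (f^[i] x) ≤ ε

/-- The chain recurrent set `CR(f)`. -/
def chainRecurrent (f : X → X) : Set X := {x | ChainReach f x x}

/-- `x` is a regularly recurrent point for `f`. -/
def RegularlyRecurrent (f : X → X) (x : X) : Prop :=
  ∀ ε > 0, ∃ k : ℕ, 1 ≤ k ∧ ∀ j : ℕ, dist x (f^[j * k] x) ≤ ε

/-- `M` is a minimal set for `f`. -/
def IsMinimalSet (f : X → X) (M : Set X) : Prop :=
  M.Nonempty ∧ IsClosed M ∧ f '' M ⊆ M ∧ ∀ y ∈ M, omegaLimitPt f y = M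

/-- A map that is chain continuous at `x` has iterates that are equicontinuous at `x`. -/
theorem ChainContinuousAt.exists_dist_iterate_le {f : X → X} (hf : Continuous f) {x : X}
    (hx : ChainContinuousAt f x) {ε : ℝ} (hε : 0 < ε) :
    ∃ r > 0, ∀ y, dist y x < r → ∀ n, dist (f^[n] y) (f^[n] x) ≤ ε := by
  obtain ⟨δ, hδ, h⟩ := hx ε hε
  obtain ⟨r, hr, hfr⟩ := Metric.continuousAt_iff.1 hf.continuousAt δ hδ
  refine ⟨min r ε, lt_min hr hε, fun y hy n => ?_⟩
  rcases n with _ | n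
  · exact (hy.trans_le (min_le_right _ _)).le
  · refine h (fun i => if i = 0 then x else f^[i] y) (fun i => ?_) rfl (n + 1)
    rcases i with _ | i
    · simpa [dist_comm] using (hfr (hy.trans_le (min_le_left _ _))).le
    · simpa [Function.iterate_succ_apply'] using hδ.le

/-- A surjection of a compact space whose iterates are equicontinuous is uniformly
almost periodic. -/
theorem exists_forall_dist_iterate_self_le [CompactSpace X] {f : X → X}
    (hsurj : Function.Surjective f)
    (heq : ∀ x, ∀ ε > 0, ∃ r > 0, ∀ y, dist y x < r → ∀ n, dist (f^[n] y) (f^[n] x) ≤ ε)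
    {ε : ℝ} (hε : 0 < ε) :
    ∃ N, 0 < N ∧ ∀ z, dist (f^[N] z) z ≤ ε := by
  choose r hr hball using fun x => heq x (ε / 3) (by positivity)
  obtain ⟨t, ht⟩ := CompactSpace.elim_nhds_subcover (fun x => Metric.ball x (r x))
    fun x => Metric.ball_mem_nhds x (hr x)
  obtain ⟨a, φ, hφ, hlim⟩ := CompactSpace.tendsto_subseq fun n (p : t) => f^[n] p.1
  obtain ⟨K, hK⟩ := Metric.cauchySeq_iff.1 hlim.cauchySeq (ε / 3) (by positivity)
  have hlt : φ K < φ (K + 1) := hφ K.lt_succ_self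
  refine ⟨φ (K + 1) - φ K, by omega, fun z => ?_⟩
  obtain ⟨w, rfl⟩ := hsurj.iterate (φ K) z
  rw [← Function.iterate_add_apply, Nat.sub_add_cancel hlt.le]
  obtain ⟨p, hp, hw⟩ : ∃ p ∈ t, w ∈ Metric.ball p (r p) := by
    have : w ∈ ⋃ x ∈ t, Metric.ball x (r x) := ht ▸ Set.mem_univ w
    simpa using this
  have h₁ := hball p w hw (φ (K + 1))
  have h₂ := hball p w hw (φ K)
  have h₃ : dist (f^[φ (K + 1)] p) (f^[φ K] p) < ε / 3 :=
    (dist_le_pi_dist (fun q : t => f^[φ (K + 1)] q.1) (fun q : t => f^[φ K] q.1) ⟨p, hp⟩).trans_lt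
      (hK (K + 1) (by omega) K le_rfl)
  have h₄ := dist_triangle4 (f^[φ (K + 1)] w) (f^[φ (K + 1)] p) (f^[φ K] p) (f^[φ K] w)
  rw [dist_comm (f^[φ K] p)] at h₄
  linarith

/-- Points of a connected component are joined by sequences with arbitrarily small steps. -/
theorem exists_seq_of_mem_connectedComponent {x y : X} (hy : y ∈ connectedComponent x)
    {δ : ℝ} (hδ : 0 < δ) :
    ∃ z : ℕ → X, (∀ k, dist (z k) (z (k + 1)) ≤ δ) ∧ z 0 = x ∧ ∃ n, z n = y := by
  let S : Set X := {y | ∃ z : ℕ → X, (∀ k, dist (z k) (z (k + 1)) ≤ δ) ∧ z 0 = x ∧ ∃ n, z n = y}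
  have step : ∀ u ∈ S, ∀ v, dist u v ≤ δ → v ∈ S := by
    rintro _ ⟨z, hz, hz0, n, rfl⟩ v hv
    refine ⟨fun k => if k ≤ n then z k else v, fun k => ?_, by simpa using hz0, n + 1, by simp⟩
    rcases lt_trichotomy k n with hk | rfl | hk
    · simpa [hk.le, Nat.succ_le_of_lt hk] using hz k
    · simpa using hv
    · simpa [show ¬ k ≤ n by omega, show ¬ k + 1 ≤ n by omega] using hδ.le
  have hopen : IsOpen S := Metric.isOpen_iff.2 fun u hu =>
    ⟨δ, hδ, fun v hv => step u hu v (by rw [dist_comm]; exact (Metric.mem_ball.1 hv).le)⟩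
  have hclosed : IsClosed S := ⟨Metric.isOpen_iff.2 fun u hu =>
    ⟨δ, hδ, fun v hv hvS => hu (step v hvS u (Metric.mem_ball.1 hv).le)⟩⟩
  have hxS : x ∈ S := ⟨fun _ => x, fun _ => by simpa using hδ.le, rfl, 0, rfl⟩
  exact IsClopen.connectedComponent_subset ⟨hclosed, hopen⟩ hxS hy

/-- Following the orbit of each point of a slowly varying sequence for an almost period `N`
gives a pseudo orbit. -/
theorem dist_map_iterate_mod_le {f : X → X} {N : ℕ} (hN : 0 < N) {δ₁ δ₂ : ℝ}
    (hper : ∀ z, dist (f^[N] z) z ≤ δ₁) {z : ℕ → X} (hz : ∀ k, dist (z k) (z (k + 1)) ≤ δ₂)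
    (i : ℕ) :
    dist (f (f^[i % N] (z (i / N)))) (f^[(i + 1) % N] (z ((i + 1) / N))) ≤ δ₁ + δ₂ := by
  have hδ₁ : 0 ≤ δ₁ := dist_nonneg.trans (hper (z 0))
  have hδ₂ : 0 ≤ δ₂ := dist_nonneg.trans (hz 0)
  rw [← Function.iterate_succ_apply' f]
  by_cases h : N ∣ i + 1
  · rw [Nat.succ_div_of_dvd h, Nat.mod_eq_zero_of_dvd h]
    have hmod : (i % N).succ = N := by
      obtain ⟨c, hc⟩ := h
      rcases c with _ | c
      · simp at hc
      · have : i = (N - 1) + N * c := by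
          rw [Nat.mul_succ] at hc
          omega
        rw [this, Nat.add_mul_mod_self_left, Nat.mod_eq_of_lt (by omega)]
        omega
    rw [hmod]
    exact (dist_triangle _ _ _).trans (add_le_add (hper _) (hz _))
  · have hmod : (i + 1) % N = i % N + 1 := by
      have h₁ := Nat.div_add_mod i N
      have h₂ := Nat.div_add_mod (i + 1) N
      rw [Nat.succ_div_of_not_dvd h] at h₂
      omega
    rw [Nat.succ_div_of_not_dvd h, hmod, Nat.succ_eq_add_one, dist_self]
    positivity

theorem stmt15 [CompactSpace X] (f : X → X) (hf : Continuous f)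
    (hsurj : Function.Surjective f) (hcc : ∀ x : X, ChainContinuousAt f x) :
    TotallyDisconnectedSpace X := by
  rw [totallyDisconnectedSpace_iff_connectedComponent_singleton]
  intro x
  refine Set.eq_singleton_iff_unique_mem.2 ⟨mem_connectedComponent, fun y hy => ?_⟩
  refine eq_of_forall_dist_le fun ε hε => ?_
  obtain ⟨δ, hδ, h⟩ := hcc x (ε / 2) (half_pos hε)
  obtain ⟨N, hN, hper⟩ := exists_forall_dist_iterate_self_le hsurj
    (fun x _ hε => (hcc x).exists_dist_iterate_le hf hε) (half_pos hδ)
  have key : ∀ z : ℕ → X, (∀ k, dist (z k) (z (k + 1)) ≤ δ / 2) → z 0 = x →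
      ∀ n, dist (z n) (f^[n * N] x) ≤ ε / 2 := by
    intro z hz hz0 n
    have := h (fun i => f^[i % N] (z (i / N)))
      (fun i => (dist_map_iterate_mod_le hN hper hz i).trans (add_halves δ).le)
      (by simpa using hz0) (n * N)
    simpa [Nat.mul_div_cancel _ hN] using this
  obtain ⟨z, hz, hz0, n, rfl⟩ := exists_seq_of_mem_connectedComponent hy (half_pos hδ)
  have h₁ := key z hz hz0 n
  have h₂ := key (fun _ => x) (fun _ => by simpa using (half_pos hδ).le) rfl n
  have h₃ := dist_triangle_right (z n) x (f^[n * N] x)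
  linarith
end

section
/- Let X be a compact metric space and f : X → X a continuous map. If every point of X is recurrent (i.e., x ∈ ω_f(x) for all x ∈ X), then every point of X is a lower semicontinuity point of the ω-limit set map ω_f. -/
open Filter Topology

variable {X : Type*} [MetricSpace X]

theorem iterate_mem_omegaLimitPt {f : X → X} (hf : Continuous f) {x y : X}
    (h : y ∈ omegaLimitPt f x) (n : ℕ) : f^[n] y ∈ omegaLimitPt f x := by
  obtain ⟨φ, hφ, hlim⟩ := h
  refine ⟨fun j => n + φ j, hφ.const_add n, ?_⟩
  simpa only [Function.iterate_add_apply, Function.comp_def] using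
    ((hf.iterate n).tendsto y).comp hlim

theorem stmt16 [CompactSpace X] (f : X → X) (hf : Continuous f)
    (hrec : ∀ x : X, x ∈ omegaLimitPt f x) :
    ∀ x : X, LSCPoint f x := by
  rintro x U hU ⟨z, ⟨φ, -, hlim⟩, hzU⟩
  obtain ⟨j, hj⟩ := (hlim.eventually (hU.mem_nhds hzU)).exists
  have hV : (f^[φ j]) ⁻¹' U ∈ 𝓝 x := (hU.preimage (hf.iterate _)).mem_nhds hj
  obtain ⟨δ, hδ, hball⟩ := Metric.nhds_basis_closedBall.mem_iff.mp hV
  exact ⟨δ, hδ, fun y hy => ⟨f^[φ j] y, iterate_mem_omegaLimitPt hf (hrec y) _,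
    hball (Metric.mem_closedBall'.mpr hy)⟩⟩
end

section
/- Let X be a compact metric space and f : X → X a continuous map, and set S = ⋂_{i≥0} f^i(X). If every point of X is a lower semicontinuity point of the ω-limit set map ω_f, then S = CR(f). -/
open Filter Topology

variable {X : Type*} [MetricSpace X]

/-- For uniformly continuous `f`, finite `δ`-chains of a fixed length stay close to true orbits. -/
theorem exists_forall_chain_dist_iterate_le {f : X → X} (hf : UniformContinuous f) (n : ℕ) :
    ∀ ε > 0, ∃ δ > 0, ∀ c : ℕ → X, (∀ j, dist (f (c j)) (c (j + 1)) ≤ δ) →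
      dist (f^[n] (c 0)) (c n) ≤ ε := by
  induction n with
  | zero => exact fun ε hε => ⟨1, one_pos, fun c _ => by simpa using hε.le⟩
  | succ n ih =>
    intro ε hε
    obtain ⟨η, hη, hfη⟩ := Metric.uniformContinuous_iff.1 hf (ε / 2) (half_pos hε)
    obtain ⟨δ, hδ, h⟩ := ih (η / 2) (half_pos hη)
    refine ⟨min δ (ε / 2), lt_min hδ (half_pos hε), fun c hc => ?_⟩
    have hn := h c fun j => (hc j).trans (min_le_left _ _)
    have hstep := (hc n).trans (min_le_right _ _)
    have himage := hfη (hn.trans_lt (half_lt_self hη))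
    rw [Function.iterate_succ_apply']
    linarith [dist_triangle (f (f^[n] (c 0))) (f (c n)) (c (n + 1))]

/-- A `δ`-chain returning to its starting point extends periodically. -/
theorem IsDeltaChain.mod_of_eq {f : X → X} {δ : ℝ} {c : ℕ → X} {k : ℕ}
    (hc : IsDeltaChain f δ c k) (hk : c k = c 0) (j : ℕ) :
    dist (f (c (j % k))) (c ((j + 1) % k)) ≤ δ := by
  have hlt : j % k < k := Nat.mod_lt _ hc.1
  have hstep := hc.2 _ hlt
  rcases (Nat.succ_le_of_lt hlt).lt_or_eq with h | h
  · rwa [← Nat.mod_add_mod, Nat.mod_eq_of_lt h]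
  · rw [← Nat.mod_add_mod, show j % k + 1 = k from h, Nat.mod_self, ← hk]
    rwa [show j % k + 1 = k from h] at hstep

theorem chainRecurrent_subset_iInter_image_iterate [CompactSpace X] {f : X → X}
    (hf : Continuous f) : chainRecurrent f ⊆ ⋂ i : ℕ, f^[i] '' Set.univ := by
  intro x hx
  refine Set.mem_iInter.2 fun i => ?_
  have hclosed : IsClosed (f^[i] '' Set.univ) :=
    (isCompact_univ.image (hf.iterate i)).isClosed
  rw [← hclosed.closure_eq, Metric.mem_closure_iff]
  intro ε hε
  obtain ⟨δ, hδ, h⟩ := exists_forall_chain_dist_iterate_le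
    (CompactSpace.uniformContinuous_of_continuous hf) i (ε / 2) (half_pos hε)
  obtain ⟨c, k, hc, h0, hk⟩ := hx δ hδ
  have hik : i * k - i + i = i * k := Nat.sub_add_cancel (Nat.le_mul_of_pos_right i hc.1)
  have hdist := h (fun j => c ((i * k - i + j) % k))
    fun j => hc.mod_of_eq (hk.trans h0.symm) (i * k - i + j)
  simp only [hik, Nat.mul_mod_left, h0] at hdist
  exact ⟨_, Set.mem_image_of_mem _ (Set.mem_univ _),
    ((dist_comm _ _).trans_le hdist).trans_lt (half_lt_self hε)⟩

theorem omegaLimitPt_nonempty [CompactSpace X] (f : X → X) (x : X) :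
    (omegaLimitPt f x).Nonempty := by
  obtain ⟨y, φ, hφ, hy⟩ := CompactSpace.tendsto_subseq fun n => f^[n] x
  exact ⟨y, φ, hφ, hy⟩

/-- Orbits visit every neighbourhood of an `ω`-limit point at arbitrarily late times. -/
theorem exists_iterate_mem_of_mem_omegaLimitPt {f : X → X} {x y : X} (hy : y ∈ omegaLimitPt f x)
    {U : Set X} (hU : IsOpen U) (hyU : y ∈ U) (n : ℕ) : ∃ m > n, f^[m] x ∈ U := by
  obtain ⟨φ, hφ, hlim⟩ := hy
  obtain ⟨j, hj, hjn⟩ := ((hlim.eventually (hU.mem_nhds hyU)).and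
    (hφ.tendsto_atTop.eventually_gt_atTop n)).exists
  exact ⟨φ j, hjn, hj⟩

/-- Jumping once from the orbit of `x` to the orbit of `y` gives a `δ`-chain. -/
theorem isDeltaChain_iterate_of_dist_le {f : X → X} {δ : ℝ} (hδ : 0 ≤ δ) {x y : X} {k : ℕ}
    (hk : 0 < k) (hxy : dist (f^[k] x) y ≤ δ) (n : ℕ) :
    IsDeltaChain f δ (fun i => if i < k then f^[i] x else f^[i - k] y) (k + n) := by
  refine ⟨by omega, fun i _ => ?_⟩
  rcases lt_trichotomy (i + 1) k with h | h | h
  · simpa [h, show i < k by omega, ← Function.iterate_succ_apply'] using hδ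
  · subst h
    simpa [← Function.iterate_succ_apply'] using hxy
  · simpa [show ¬ i + 1 < k by omega, show ¬ i < k by omega,
      show i + 1 - k = i - k + 1 by omega, ← Function.iterate_succ_apply'] using hδ

theorem iInter_image_iterate_subset_chainRecurrent [CompactSpace X] {f : X → X}
    (hf : Continuous f) (hlsc : ∀ x : X, LSCPoint f x) :
    (⋂ i : ℕ, f^[i] '' Set.univ) ⊆ chainRecurrent f := by
  intro x hx δ hδ
  have hpre : ∀ n, ∃ y, f^[n] y = x := fun n => by simpa using Set.mem_iInter.1 hx n
  choose y hy using hpre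
  obtain ⟨z, φ, hφ, hz⟩ := CompactSpace.tendsto_subseq y
  obtain ⟨w, hw⟩ := omegaLimitPt_nonempty f z
  have hwU : w ∈ Metric.ball w (δ / 2) := Metric.mem_ball_self (half_pos hδ)
  obtain ⟨η, hη, hzη⟩ := hlsc z _ Metric.isOpen_ball ⟨w, hw, hwU⟩
  obtain ⟨m, -, hm⟩ := exists_iterate_mem_of_mem_omegaLimitPt hw Metric.isOpen_ball hwU 0
  obtain ⟨j, ⟨hjη, hjU⟩, hjm⟩ := ((((hz.eventually (Metric.ball_mem_nhds z hη)).and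
    ((((hf.iterate m).tendsto z).comp hz).eventually (Metric.isOpen_ball.mem_nhds hm))).and
    (hφ.tendsto_atTop.eventually_ge_atTop m))).exists
  simp only [Function.comp_apply] at hjη hjU
  obtain ⟨n, hn⟩ : ∃ n, φ j = n := ⟨_, rfl⟩
  rw [hn] at hjη hjU hjm
  obtain ⟨u, hu, huU⟩ := hzη (y n) (by rw [dist_comm]; exact (Metric.mem_ball.1 hjη).le)
  obtain ⟨l, hl, hlU⟩ := exists_iterate_mem_of_mem_omegaLimitPt hu Metric.isOpen_ball huU n
  rw [← Nat.sub_add_cancel hl.le, Function.iterate_add_apply, hy] at hlU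
  have hdist : dist (f^[l - n] x) (f^[m] (y n)) ≤ δ := by
    have h := dist_triangle_right (f^[l - n] x) (f^[m] (y n)) w
    linarith [Metric.mem_ball.1 hlU, Metric.mem_ball.1 hjU]
  have hpos : 0 < l - n := Nat.sub_pos_of_lt hl
  refine ⟨_, _, isDeltaChain_iterate_of_dist_le hδ.le hpos hdist (n - m), ?_, ?_⟩
  · simp [hpos]
  · simp only [Nat.not_lt.2 (Nat.le_add_right _ _), if_false, Nat.add_sub_cancel_left]
    rw [← Function.iterate_add_apply, Nat.sub_add_cancel hjm, hy]

theorem stmt18 [CompactSpace X] (f : X → X) (hf : Continuous f)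
    (hlsc : ∀ x : X, LSCPoint f x) :
    (⋂ i : ℕ, f^[i] '' Set.univ) = chainRecurrent f := by
  exact (iInter_image_iterate_subset_chainRecurrent hf hlsc).antisymm
    (chainRecurrent_subset_iInter_image_iterate hf)
end
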